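/- Let (Ω, μ, T) be an ergodic probability-preserving dynamical system, f : Ω → Z^d measurable, and M_n := sum_{k=0}^{n-1} f∘T^k. If μ(M_n = 0) = O(n^{-θ}) for some θ > 1, then R_n/n converges μ-almost surely to μ(M_j ≠ 0 for all j ≥ 1), where R_n := #{M_0,...,M_n}. -/

import Mathlib

open MeasureTheory Filter Finset Topology

noncomputable def maxF {Ω : Type*} (T : Ω → Ω) (g : Ω → ℝ) : ℕ → Ω → ℝ
  | 0 => fun _ => 0
  | n + 1 => fun ω => max 0 (g ω + maxF T g n (T ω))

theorem maxF_nonneg {Ω : Type*} (T : Ω → Ω) (g : Ω → ℝ) (n : ℕ) (ω : Ω) :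
    0 ≤ maxF T g n ω := by
  cases n <;> simp [maxF]

theorem maxF_mono {Ω : Type*} (T : Ω → Ω) (g : Ω → ℝ) (n : ℕ) :
    ∀ ω, maxF T g n ω ≤ maxF T g (n + 1) ω := by
  induction n with
  | zero => intro ω; exact maxF_nonneg T g 1 ω
  | succ n ih =>
    intro ω
    have := ih (T ω)
    change max 0 (g ω + maxF T g n (T ω)) ≤ max 0 (g ω + maxF T g (n + 1) (T ω))
    gcongr

theorem maxF_bound {Ω : Type*} (T : Ω → Ω) (g : Ω → ℝ) (B : ℝ) (hB : ∀ ω, |g ω| ≤ B) (n : ℕ) :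
    ∀ ω, maxF T g n ω ≤ n * B := by
  induction n with
  | zero => intro ω; simp [maxF]
  | succ n ih =>
    intro ω
    have h1 := ih (T ω)
    have h2 := abs_le.1 (hB ω)
    have h3 := maxF_nonneg T g n (T ω)
    have h4 := (abs_nonneg _).trans (hB ω)
    change max 0 (g ω + maxF T g n (T ω)) ≤ _
    push_cast
    apply max_le <;> nlinarith

theorem birkhoff_le_maxF {Ω : Type*} (T : Ω → Ω) (g : Ω → ℝ) (n : ℕ) :
    ∀ ω, ∑ k ∈ Finset.range n, g (T^[k] ω) ≤ maxF T g n ω := by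
  induction n with
  | zero => intro ω; simp [maxF]
  | succ n ih =>
    intro ω
    rw [Finset.sum_range_succ']
    have := ih (T ω)
    simp only [Function.iterate_succ, Function.comp, Function.iterate_zero, id]
    change _ ≤ max 0 (g ω + maxF T g n (T ω))
    refine le_max_of_le_right ?_
    linarith

theorem maxF_meas {Ω : Type*} [MeasurableSpace Ω] (T : Ω → Ω) (hT : Measurable T)
    (g : Ω → ℝ) (hg : Measurable g) (n : ℕ) : Measurable (maxF T g n) := by
  induction n with
  | zero => exact measurable_const
  | succ n ih => exact measurable_const.max (hg.add (ih.comp hT))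

theorem maximal_bdd {Ω : Type*} [MeasurableSpace Ω]
    (μ : Measure Ω) [IsProbabilityMeasure μ]
    (T : Ω → Ω) (hT : Ergodic T μ) (g : Ω → ℝ) (hg : Measurable g) (B : ℝ)
    (hB : ∀ ω, |g ω| ≤ B) (hneg : ∫ ω, g ω ∂μ < 0) :
    ∀ᵐ ω ∂μ, ∃ K : ℕ, ∀ n, ∑ k ∈ Finset.range n, g (T^[k] ω) ≤ K := by
  have hTm := hT.measurable
  have hFm := maxF_meas T hTm g hg
  set E : Set Ω := {ω | ∀ K : ℕ, ∃ n, (K : ℝ) < maxF T g n ω} with hE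
  have hEm : MeasurableSet E := by
    have : E = ⋂ K : ℕ, ⋃ n, {ω | (K : ℝ) < maxF T g n ω} := by
      ext; simp [hE]
    rw [this]
    exact MeasurableSet.iInter fun K => MeasurableSet.iUnion fun n =>
      measurableSet_lt measurable_const (hFm n)
  have hinv : T ⁻¹' E = E := by
    ext ω
    obtain ⟨b, hb⟩ := exists_nat_gt B
    have h2 := abs_le.1 (hB ω)
    constructor
    · intro h K
      obtain ⟨n, hn⟩ := h (K + b)
      refine ⟨n + 1, ?_⟩
      change _ < max 0 (g ω + maxF T g n (T ω))
      refine lt_max_of_lt_right ?_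
      push_cast at hn
      linarith
    · intro h K
      obtain ⟨n, hn⟩ := h (K + b)
      refine ⟨n, ?_⟩
      replace hn := hn.trans_le (maxF_mono T g n ω)
      change _ < max 0 (g ω + maxF T g n (T ω)) at hn
      push_cast at hn
      have hK : (0 : ℝ) ≤ K := Nat.cast_nonneg K
      have hb0 : (0 : ℝ) ≤ b := Nat.cast_nonneg b
      rcases lt_max_iff.1 hn with h | h <;> linarith
  have hint : ∀ n, Integrable (maxF T g n) μ := fun n =>
    Integrable.of_bound (hFm n).aestronglyMeasurable (n * B) (ae_of_all _ fun ω => by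
      rw [Real.norm_eq_abs, abs_of_nonneg (maxF_nonneg T g n ω)]
      exact maxF_bound T g B hB n ω)
  have hintT : ∀ n, Integrable (fun ω => maxF T g n (T ω)) μ := fun n =>
    hT.toMeasurePreserving.integrable_comp_of_integrable (hint n)
  rcases hT.toPreErgodic.ae_empty_or_univ hEm hinv with h0 | h1
  · have : ∀ᵐ ω ∂μ, ω ∉ E := by
      filter_upwards [h0] with ω h hω
      exact (iff_of_eq h).1 hω
    filter_upwards [this] with ω hω
    simp only [hE, Set.mem_ofPred_eq, not_forall, not_exists, not_lt] at hω
    obtain ⟨K, hK⟩ := hω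
    exact ⟨K, fun n => (birkhoff_le_maxF T g n ω).trans (hK n)⟩
  · exfalso
    have hae : ∀ᵐ ω ∂μ, ω ∈ E := by
      filter_upwards [h1] with ω h
      exact (iff_of_eq h).2 trivial
    have hlim : Tendsto (fun n => ∫ ω, (maxF T g (n + 1) ω - maxF T g n (T ω)) ∂μ) atTop
        (𝓝 (∫ ω, g ω ∂μ)) := by
      refine tendsto_integral_of_dominated_convergence (fun _ => B) (fun n => ?_)
        (integrable_const B) (fun n => ae_of_all _ fun ω => ?_) ?_
      · exact ((hFm (n + 1)).sub ((hFm n).comp hTm)).aestronglyMeasurable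
      · have h2 := abs_le.1 (hB ω)
        have h3 := maxF_nonneg T g n (T ω)
        rw [Real.norm_eq_abs, abs_le]
        change _ ≤ max 0 (g ω + maxF T g n (T ω)) - _ ∧ max 0 (g ω + maxF T g n (T ω)) - _ ≤ _
        rcases max_cases 0 (g ω + maxF T g n (T ω)) with ⟨h, h'⟩ | ⟨h, h'⟩ <;> rw [h] <;>
          constructor <;> linarith
      · filter_upwards [hae] with ω hω
        rw [← hinv] at hω
        obtain ⟨b, hb⟩ := exists_nat_gt B
        obtain ⟨n₀, hn₀⟩ := hω b
        have hmono : Monotone fun n => maxF T g n (T ω) :=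
          monotone_nat_of_le_succ fun n => maxF_mono T g n (T ω)
        refine tendsto_const_nhds.congr' ?_
        filter_upwards [eventually_ge_atTop n₀] with n hn
        have h4 := hmono hn
        have h2 := abs_le.1 (hB ω)
        change _ = max 0 (g ω + maxF T g n (T ω)) - _
        simp only at h4
        rw [max_eq_right (by linarith)]
        ring
    have hnn : ∀ n, 0 ≤ ∫ ω, (maxF T g (n + 1) ω - maxF T g n (T ω)) ∂μ := by
      intro n
      rw [integral_sub (hint _) (hintT n)]
      have : ∫ ω, maxF T g n (T ω) ∂μ = ∫ ω, maxF T g n ω ∂μ := by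
        have h := integral_map (μ := μ) hTm.aemeasurable
          (f := maxF T g n) (hFm n).aestronglyMeasurable
        rw [hT.toMeasurePreserving.map_eq] at h
        exact h.symm
      rw [this, sub_nonneg]
      exact integral_mono (hint _) (hint _) (maxF_mono T g n)
    have := ge_of_tendsto' hlim hnn
    linarith

open Classical in
theorem visits_le {Ω : Type*} [MeasurableSpace Ω]
    (μ : Measure Ω) [IsProbabilityMeasure μ]
    (T : Ω → Ω) (hT : Ergodic T μ) (A : Set Ω) (hA : MeasurableSet A) (c : ℝ)
    (hc : (μ A).toReal < c) :
    ∀ᵐ ω ∂μ, ∃ K : ℕ, ∀ n : ℕ,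
      (((Finset.range n).filter (fun k => T^[k] ω ∈ A)).card : ℝ) ≤ c * n + K := by
  have hi : Integrable (A.indicator (fun _ => (1 : ℝ))) μ := (integrable_const 1).indicator hA
  have hm : Measurable (A.indicator (fun _ => (1 : ℝ))) := measurable_const.indicator hA
  have := maximal_bdd μ T hT (fun ω => A.indicator (fun _ => (1 : ℝ)) ω - c)
    (hm.sub measurable_const) (1 + |c|)
    (fun ω => by
      refine (abs_sub _ _).trans ?_
      gcongr
      by_cases h : ω ∈ A <;> simp [h])
    (by
      rw [integral_sub hi (integrable_const c), integral_indicator hA]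
      simp [Measure.real]
      exact hc)
  filter_upwards [this] with ω ⟨K, hK⟩
  refine ⟨K, fun n => ?_⟩
  have h := hK n
  rw [Finset.sum_sub_distrib] at h
  simp only [Set.indicator_apply, Finset.sum_boole, Finset.sum_const, Finset.card_range,
    nsmul_eq_mul] at h
  linarith

open MeasureTheory Filter Finset Topology in
/-- for an ergodic cocycle walk `M_n = ∑_{k<n} f∘T^k` with
`μ(M_n = 0) = O(n^{-θ})`, `θ > 1`, the range satisfies
`R_n/n → μ(M_j ≠ 0 ∀ j ≥ 1)` almost surely. -/
theorem range_div_n_tendsto_escape {d : ℕ} {Ω : Type*} [MeasurableSpace Ω]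
    (μ : Measure Ω) [IsProbabilityMeasure μ]
    (T : Ω → Ω) (hT : Ergodic T μ)
    (f : Ω → (Fin d → ℤ)) (hf : Measurable f)
    (M : ℕ → Ω → (Fin d → ℤ))
    (hM : ∀ n ω, M n ω = ∑ k ∈ Finset.range n, f (T^[k] ω))
    (θ C : ℝ) (hθ : 1 < θ)
    (hret : ∀ n : ℕ, 1 ≤ n → (μ {ω | M n ω = 0}).toReal ≤ C * (n : ℝ) ^ (-θ)) :
    ∀ᵐ ω ∂μ, Tendsto
      (fun n : ℕ => (((Finset.range (n + 1)).image (fun k => M k ω)).card : ℝ) / n)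
      atTop (𝓝 ((μ {ω | ∀ j ≥ 1, M j ω ≠ 0}).toReal)) := by
  classical
  have hMm : ∀ n, Measurable (M n) := by
    intro n
    have : M n = fun ω => ∑ k ∈ Finset.range n, f (T^[k] ω) := funext (hM n)
    rw [this]
    exact Finset.measurable_sum _ fun k _ => hf.comp (hT.measurable.iterate k)
  have hadd : ∀ k j ω, M (k + j) ω = M k ω + M j (T^[k] ω) := by
    intro k j ω
    rw [hM, hM, hM, Finset.sum_range_add]
    congr 1
    refine Finset.sum_congr rfl fun i _ => ?_
    rw [add_comm k i, Function.iterate_add_apply]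
  set A : Set Ω := {ω | ∀ j ≥ 1, M j ω ≠ 0} with hA
  set D : ℕ → Set Ω := fun m => {ω | ∀ j ≥ 1, j ≤ m → M j ω ≠ 0} with hD
  have hzm : ∀ j, MeasurableSet {ω | M j ω ≠ 0} := fun j =>
    (hMm j (measurableSet_singleton 0)).compl
  have hDm : ∀ m, MeasurableSet (D m) := by
    intro m
    have : D m = ⋂ j, ⋂ (_ : j ≥ 1), ⋂ (_ : j ≤ m), {ω | M j ω ≠ 0} := by
      ext; simp [hD]
    rw [this]
    exact MeasurableSet.iInter fun j => MeasurableSet.iInter fun _ =>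
      MeasurableSet.iInter fun _ => hzm j
  have hAD : A = ⋂ m, D m := by
    ext ω
    simp only [hA, hD, Set.mem_iInter, Set.mem_ofPred_eq]
    exact ⟨fun h m j hj _ => h j hj, fun h j hj => h j j hj le_rfl⟩
  have hAm : MeasurableSet A := hAD ▸ MeasurableSet.iInter hDm
  have hlim : Tendsto (fun m => (μ (D m)).toReal) atTop (𝓝 (μ A).toReal) := by
    refine (ENNReal.tendsto_toReal (measure_ne_top μ A)).comp ?_
    rw [hAD]
    refine tendsto_measure_iInter_atTop (fun m => (hDm m).nullMeasurableSet) ?_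
      ⟨0, measure_ne_top _ _⟩
    intro a b hab ω h j hj hja
    exact h j hj (hja.trans hab)
  set a := (μ A).toReal with ha
  -- combinatorial bounds
  have hlow : ∀ ω n, ((Finset.range (n + 1)).filter (fun k => T^[k] ω ∈ A)).card ≤
      ((Finset.range (n + 1)).image (fun k => M k ω)).card := by
    intro ω n
    have key : ∀ k l, T^[k] ω ∈ A → k < l → M k ω ≠ M l ω := by
      intro k l hk hkl h
      obtain ⟨j, rfl⟩ := Nat.exists_eq_add_of_lt hkl
      rw [add_assoc, hadd] at h
      exact hk (j + 1) (by omega) (by simpa using h.symm)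
    rw [← Finset.card_image_of_injOn (f := fun k => M k ω)
      (s := (Finset.range (n + 1)).filter (fun k => T^[k] ω ∈ A))]
    · exact Finset.card_le_card (Finset.image_subset_image (Finset.filter_subset _ _))
    · intro k hk l hl h
      simp only [Finset.coe_filter, Set.mem_ofPred_eq] at hk hl
      rcases lt_trichotomy k l with h' | h' | h'
      · exact absurd h (key k l hk.2 h')
      · exact h'
      · exact absurd h.symm (key l k hl.2 h')
  have hup : ∀ m ω n, ((Finset.range (n + 1)).image (fun k => M k ω)).card ≤
      ((Finset.range (n + 1)).filter (fun k => T^[k] ω ∈ D m)).card + m := by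
    intro m ω n
    have hsub : (Finset.range (n + 1)).image (fun k => M k ω) ⊆
        ((Finset.range (n + 1)).filter (fun k => T^[k] ω ∈ D m) ∪
          Finset.Ico (n + 1 - m) (n + 1)).image (fun k => M k ω) := by
      intro x hx
      obtain ⟨k₀, hk₀, hk₀x⟩ := Finset.mem_image.1 hx
      have hne : ((Finset.range (n + 1)).filter (fun k => M k ω = x)).Nonempty :=
        ⟨k₀, by simp only [Finset.mem_filter]; exact ⟨hk₀, hk₀x⟩⟩
      obtain ⟨k, hk, hmax⟩ := Finset.exists_max_image _ id hne
      simp only [Finset.mem_filter, Finset.mem_range, id] at hk hmax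
      refine Finset.mem_image.2 ⟨k, ?_, hk.2⟩
      simp only [Finset.mem_union, Finset.mem_filter, Finset.mem_range, Finset.mem_Ico]
      by_cases hkm : n + 1 - m ≤ k
      · exact Or.inr ⟨hkm, hk.1⟩
      · refine Or.inl ⟨hk.1, fun j hj hjm h0 => ?_⟩
        have := hmax (k + j) ⟨by omega, by rw [hadd, h0, add_zero, hk.2]⟩
        omega
    refine (Finset.card_le_card hsub).trans (Finset.card_image_le.trans
      ((Finset.card_union_le _ _).trans ?_))
    simp only [Nat.card_Ico]
    omega
  have hε : ∀ i : ℕ, ∀ᵐ ω ∂μ, ∃ K : ℝ, ∀ n : ℕ,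
      |(((Finset.range (n + 1)).image (fun k => M k ω)).card : ℝ) - a * (n + 1)|
        ≤ 1 / ((i : ℝ) + 1) * (n + 1) + K := by
    intro i
    set e : ℝ := 1 / ((i : ℝ) + 1) with he
    have he0 : 0 < e := by positivity
    obtain ⟨m, hm⟩ := (hlim.eventually (gt_mem_nhds (show a < a + e by linarith))).exists
    have hcompl : (μ Aᶜ).toReal < 1 - a + e := by
      have := probReal_compl_eq_one_sub (μ := μ) hAm
      simp only [Measure.real] at this
      rw [this]; linarith
    filter_upwards [visits_le μ T hT (D m) (hDm m) _ hm,
      visits_le μ T hT Aᶜ hAm.compl _ hcompl] with ω ⟨K₁, h1⟩ ⟨K₂, h2⟩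
    refine ⟨K₁ + K₂ + m, fun n => ?_⟩
    have h1 : (((Finset.range (n + 1)).filter (fun k => T^[k] ω ∈ D m)).card : ℝ) ≤
        (a + e) * ((n + 1 : ℕ) : ℝ) + K₁ := by convert h1 (n + 1)
    have h2 : (((Finset.range (n + 1)).filter (fun k => T^[k] ω ∈ Aᶜ)).card : ℝ) ≤
        (1 - a + e) * ((n + 1 : ℕ) : ℝ) + K₂ := by convert h2 (n + 1)
    have h3 : ((((Finset.range (n + 1)).image (fun k => M k ω)).card : ℕ) : ℝ) ≤ _ :=
      Nat.cast_le.2 (hup m ω n)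
    have h4 : _ ≤ ((((Finset.range (n + 1)).image (fun k => M k ω)).card : ℕ) : ℝ) :=
      Nat.cast_le.2 (hlow ω n)
    have h5 := Finset.card_filter_add_card_filter_not (s := Finset.range (n + 1))
      (fun k => T^[k] ω ∈ A)
    rw [Finset.card_range] at h5
    have h6 : (((Finset.range (n + 1)).filter (fun k => T^[k] ω ∈ A)).card : ℝ) +
      ((Finset.range (n + 1)).filter (fun k => T^[k] ω ∈ Aᶜ)).card = n + 1 := by
      exact_mod_cast h5
    push_cast at h1 h2 h3
    have hK1 : (0 : ℝ) ≤ K₁ := Nat.cast_nonneg _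
    have hK2 : (0 : ℝ) ≤ K₂ := Nat.cast_nonneg _
    have hm0 : (0 : ℝ) ≤ m := Nat.cast_nonneg _
    rw [abs_le]
    constructor <;> nlinarith
  filter_upwards [ae_all_iff.2 hε] with ω hω
  rw [Metric.tendsto_atTop]
  intro ε hε0
  obtain ⟨i, hi⟩ := exists_nat_one_div_lt (half_pos hε0)
  obtain ⟨K, hK⟩ := hω i
  obtain ⟨N, hN⟩ := exists_nat_gt ((|a| + ε / 2 + |K|) / (ε / 2))
  refine ⟨N + 1, fun n hn => ?_⟩
  have hn1 : (N : ℝ) + 1 ≤ n := by exact_mod_cast hn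
  have hN0 : (0 : ℝ) ≤ N := Nat.cast_nonneg _
  have hnpos : (0 : ℝ) < n := by linarith
  rw [div_lt_iff₀ (half_pos hε0)] at hN
  have h := abs_le.1 (hK n)
  rw [Real.dist_eq, div_sub' hnpos.ne', abs_div, abs_of_pos hnpos, div_lt_iff₀ hnpos, abs_lt]
  have h7 : 1 / ((i : ℝ) + 1) * (n + 1) ≤ ε / 2 * (n + 1) := by gcongr
  have h8 := abs_le.1 (le_refl |a|)
  have h9 := le_abs_self K
  constructor <;> nlinarith
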